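/- Let r ≥ 3 and k ≥ 1 be integers and set c₀ = 4er^2·binom(k+r-2, r-1)·((2k+2r-3)e)^{1/binom(k+r-2, r-1)}. For every ε > 0 there exists C₀ ≥ c₀ such that for every C ≥ C₀, with p = C·n^{-1/binom(k+r-2, r-1)} and X the random variable counting the number of σ ∈ Q_n with H_σ ⊆ H^{(r)}(n,p), one has E[X²] ≤ (1+ε)·E[X]² for all sufficiently large n. -/

import Mathlib

open scoped Classical
open Finset

noncomputable section

/-- The window of `k+r-1` cyclically consecutive vertices starting at position `i`,
under the cyclic ordering `σ`. -/
def cycWindow (k r n : ℕ) (σ : ZMod n → Fin n) (i : ZMod n) : Finset (Fin n) :=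
  (Finset.range (k + r - 1)).image fun j => σ (i + (j : ZMod n))

/-- The edge set of the `k`th power of a tight Hamilton cycle on `[n]` associated with
the cyclic ordering `σ`: all `r`-sets contained in some window of `k+r-1`
cyclically consecutive vertices. -/
def hamPowEdges (r k n : ℕ) (σ : ZMod n → Fin n) : Finset (Finset (Fin n)) :=
  Finset.univ.filter fun e => e.card = r ∧ ∃ i : ZMod n, e ⊆ cycWindow k r n σ i

/-- All `r`-element subsets of `Fin n`. -/
def rSets (n r : ℕ) : Finset (Finset (Fin n)) := Finset.univ.filter fun e => e.card = r

/-- The probability weight of a given `r`-graph `H` in the binomial random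
`r`-graph `H^{(r)}(n,p)`. -/
def prW (n r : ℕ) (p : ℝ) (H : Finset (Finset (Fin n))) : ℝ :=
  p ^ H.card * (1 - p) ^ ((rSets n r).card - H.card)

/-- The probability that `H^{(r)}(n,p)` satisfies the property `A`. -/
def probOf (n r : ℕ) (p : ℝ) (A : Finset (Finset (Fin n)) → Prop) : ℝ :=
  ∑ H ∈ (rSets n r).powerset, if A H then prW n r p H else 0

/-- The expectation of `f` with respect to the random `r`-graph `H^{(r)}(n,p)`. -/
def expct (n r : ℕ) (p : ℝ) (f : Finset (Finset (Fin n)) → ℝ) : ℝ :=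
  ∑ H ∈ (rSets n r).powerset, prW n r p H * f H

/-- `H` contains (a spanning copy of) the `k`th power of a tight Hamilton cycle. -/
def containsHamPow (r k n : ℕ) (H : Finset (Finset (Fin n))) : Prop :=
  ∃ σ : ZMod n → Fin n, Function.Bijective σ ∧ hamPowEdges r k n σ ⊆ H

/-- Degree of a vertex in a hypergraph given by its edge set. -/
def degOf (n : ℕ) (H : Finset (Finset (Fin n))) (v : Fin n) : ℕ :=
  (H.filter fun e => v ∈ e).card

/-- The auxiliary graph on the edges of a hypergraph `P`, two edges being adjacent
iff they are distinct and share a vertex. -/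
def edgeGraph {n : ℕ} (P : Finset (Finset (Fin n))) : SimpleGraph {e // e ∈ P} :=
  SimpleGraph.fromRel fun e f => (e.1 ∩ f.1).Nonempty

/-- The number of connected components of the hypergraph with edge set `P`. -/
def numComp {n : ℕ} (P : Finset (Finset (Fin n))) : ℕ :=
  Nat.card (edgeGraph P).ConnectedComponent

/-- The set of vertices covered by the edges of `P`. -/
def vertsOf {n : ℕ} (P : Finset (Finset (Fin n))) : Finset (Fin n) := P.biUnion id

/-- `σ` is the canonical representative of a cyclic ordering of `[n]`
(a permutation considered up to rotation and reflection). -/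
def IsCycRep (n : ℕ) (σ : ZMod n → Fin n) : Prop :=
  Function.Bijective σ ∧ (σ 0).val = 0 ∧ (σ 1).val < (σ (-1)).val

/-- `|Q_n|`, the number of cyclic orderings of `[n]`. -/
def QCard (n : ℕ) : ℕ := Nat.card {σ : ZMod n → Fin n // IsCycRep n σ}

/-- `N_σ(b)`: the number of cyclic orderings `τ ∈ Q_n` such that `H_σ` and `H_τ`
share exactly `b` edges. -/
def NQ (r k n : ℕ) (σ : ZMod n → Fin n) (b : ℕ) : ℕ :=
  Nat.card {τ : ZMod n → Fin n //
    IsCycRep n τ ∧ (hamPowEdges r k n σ ∩ hamPowEdges r k n τ).card = b}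

/-- `N_σ(b,s)`: the number of cyclic orderings `τ ∈ Q_n` such that `H_σ ∩ H_τ`
has exactly `b` edges and exactly `s` connected components. -/
def NQs (r k n : ℕ) (σ : ZMod n → Fin n) (b s : ℕ) : ℕ :=
  Nat.card {τ : ZMod n → Fin n //
    IsCycRep n τ ∧ (hamPowEdges r k n σ ∩ hamPowEdges r k n τ).card = b ∧
      numComp (hamPowEdges r k n σ ∩ hamPowEdges r k n τ) = s}

/-- The random variable `X`: the number of cyclic orderings `σ ∈ Q_n` with `H_σ ⊆ H`. -/
def XH (r k n : ℕ) (H : Finset (Finset (Fin n))) : ℝ :=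
  Nat.card {σ : ZMod n → Fin n // IsCycRep n σ ∧ hamPowEdges r k n σ ⊆ H}

/-- The auxiliary graph on a finite set `P` of edges of a simple graph, two edges
being adjacent iff they are distinct and share a vertex. -/
def edgeGraphS {V : Type*} (P : Finset (Sym2 V)) : SimpleGraph {e // e ∈ P} :=
  SimpleGraph.fromRel fun e f => ∃ x, x ∈ e.1 ∧ x ∈ f.1

theorem pow_le_three_pow_mul_descFactorial (v : ℕ) :
    ∀ n : ℕ, v ≤ n → n ^ v ≤ 3 ^ v * n.descFactorial v := by
  induction v with
  | zero => intro n _; simp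
  | succ v ih =>
    intro n hn
    obtain ⟨m, rfl⟩ : ∃ m, n = m + 1 := ⟨n - 1, by omega⟩
    have hv : v ≤ m := by omega
    have key : (m + 1) ^ v ≤ 3 * m ^ v := by
      rcases Nat.eq_zero_or_pos m with rfl | hm
      · obtain rfl : v = 0 := by omega
        simp
      have hm' : (0 : ℝ) < m := by exact_mod_cast hm
      have h1 : ((m : ℝ) + 1) ^ v ≤ 3 * (m : ℝ) ^ v := by
        have h2 : ((m : ℝ) + 1) = m * (1 + 1 / m) := by field_simp
        rw [h2, mul_pow, mul_comm]
        gcongr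
        calc (1 + 1 / (m : ℝ)) ^ v ≤ (Real.exp (1 / m)) ^ v := by
              gcongr
              linarith [Real.add_one_le_exp (1 / (m : ℝ))]
          _ = Real.exp (v / m) := by rw [← Real.exp_nat_mul]; congr 1; ring
          _ ≤ Real.exp 1 := by
              gcongr
              rw [div_le_one hm']
              exact_mod_cast hv
          _ ≤ 3 := Real.exp_one_lt_three.le
      exact_mod_cast h1
    rw [Nat.succ_descFactorial_succ, pow_succ, pow_succ]
    calc (m + 1) ^ v * (m + 1) ≤ (3 * m ^ v) * (m + 1) := by gcongr
      _ ≤ (3 * (3 ^ v * m.descFactorial v)) * (m + 1) := by gcongr; exact ih m hv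
      _ = _ := by ring

theorem card_perm_agreeing_le {α : Type*} [Fintype α] (V : Finset α) (A : Finset (Equiv.Perm α))
    (h : ∀ π ∈ A, ∀ ρ ∈ A, ∀ t ∈ V, π t = ρ t) :
    #A ≤ (Fintype.card α - #V).factorial := by
  rcases A.eq_empty_or_nonempty with rfl | ⟨ρ, hρ⟩
  · simp
  have h1 : #A ≤ Fintype.card {f : Equiv.Perm α // ∀ a, ¬ (a ∉ V) → f a = a} := by
    rw [← Fintype.card_coe]
    refine Fintype.card_le_of_injective
      (fun π => ⟨ρ⁻¹ * π.1, fun a ha => ?_⟩) (fun π π' hh => ?_)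
    · rw [not_not] at ha
      rw [Equiv.Perm.mul_apply, h π.1 π.2 ρ hρ a ha]
      exact ρ.symm_apply_apply a
    · exact Subtype.ext (mul_left_cancel (Subtype.ext_iff.1 hh))
  refine h1.trans (le_of_eq ?_)
  rw [← Fintype.card_congr (Equiv.Perm.subtypeEquivSubtypePerm (fun a => a ∉ V)),
    Fintype.card_perm]
  congr 1
  simp [Fintype.card_subtype_compl]

/-- Permutations whose value at each point of `S` is a prescribed function of the value at a
predecessor of lower rank form a fraction at most `(9 / |α|) ^ |S|` of all permutations. -/
theorem card_perm_recursive_le {α : Type*} [Fintype α] (S : Finset α) (q : α → α)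
    (rank : α → ℕ) (f : α → α → α) (hq : ∀ t ∈ S, rank (q t) < rank t) :
    #{π : Equiv.Perm α | ∀ t ∈ S, π t = f t (π (q t))} * Fintype.card α ^ #S ≤
      9 ^ #S * (Fintype.card α).factorial := by
  set n := Fintype.card α
  set V := S ∪ S.image q
  have hVn : #V ≤ n := Finset.card_le_univ V
  have hSV : S ⊆ V := subset_union_left
  have hV2 : #V ≤ 2 * #S := by
    have h1 : #V ≤ #S + #(S.image q) := card_union_le _ _
    have h2 : #(S.image q) ≤ #S := card_image_le
    omega
  have hc : #(V \ S) + #S = #V := by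
    rw [card_sdiff_of_subset hSV]
    have := card_le_card hSV
    omega
  set A : Finset (Equiv.Perm α) := {π : Equiv.Perm α | ∀ t ∈ S, π t = f t (π (q t))}
  have hdet : ∀ π ∈ A, ∀ ρ ∈ A, (∀ t ∈ V \ S, π t = ρ t) → ∀ t ∈ V, π t = ρ t := by
    intro π hπ ρ hρ hag
    simp only [A, mem_filter, mem_univ, true_and] at hπ hρ
    suffices ∀ m, ∀ t ∈ V, rank t = m → π t = ρ t from fun t ht => this _ t ht rfl
    intro m
    induction m using Nat.strong_induction_on with
    | _ m ih =>
      intro t ht htm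
      by_cases hS : t ∈ S
      · rw [hπ t hS, hρ t hS,
          ih (rank (q t)) (htm ▸ hq t hS) (q t)
            (mem_union_right _ (mem_image_of_mem q hS)) rfl]
      · exact hag t (mem_sdiff.2 ⟨ht, hS⟩)
  have hA : #A ≤ (n - #V).factorial * n ^ #(V \ S) := by
    have := Finset.card_le_mul_card_image_of_maps_to (s := A)
      (t := (univ : Finset ((V \ S : Finset α) → α)))
      (f := fun π t => π t.1) (fun _ _ => mem_univ _) (n - #V).factorial ?_
    · rwa [card_univ, Fintype.card_fun, Fintype.card_coe] at this
    · intro b _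
      apply card_perm_agreeing_le
      intro π hπ ρ hρ
      rw [mem_filter] at hπ hρ
      refine hdet π hπ.1 ρ hρ.1 fun t ht => ?_
      have := congrFun (hπ.2.trans hρ.2.symm) ⟨t, ht⟩
      exact this
  calc #A * n ^ #S ≤ (n - #V).factorial * n ^ #(V \ S) * n ^ #S := by gcongr
    _ = (n - #V).factorial * n ^ #V := by rw [mul_assoc, ← pow_add, hc]
    _ ≤ (n - #V).factorial * (3 ^ #V * n.descFactorial #V) := by
        gcongr; exact pow_le_three_pow_mul_descFactorial _ _ hVn
    _ = 3 ^ #V * n.factorial := by rw [← Nat.factorial_mul_descFactorial hVn]; ring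
    _ ≤ 3 ^ (2 * #S) * n.factorial := by gcongr; norm_num
    _ = _ := by rw [pow_mul]; norm_num

/-- The positions whose image is at cyclic distance at most `w` from the image of one of the
`w` preceding positions. -/
def nearSet {n : ℕ} [NeZero n] (w : ℕ) (π : Equiv.Perm (ZMod n)) : Finset (ZMod n) :=
  univ.filter fun t => ∃ u : Fin w, ∃ d : Fin (2 * w + 1),
    π t = π (t - ((u : ℕ) + 1 : ℕ)) + (((d : ℕ) : ZMod n) - (w : ZMod n))

theorem ZMod.val_sub_natCast {n : ℕ} [NeZero n] (t : ZMod n) (u : ℕ) (h : u ≤ t.val) :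
    (t - (u : ZMod n)).val = t.val - u := by
  have hu : ((u : ℕ) : ZMod n).val = u := ZMod.val_cast_of_lt (h.trans_lt t.val_lt)
  rw [ZMod.val_sub (by rwa [hu]), hu]

theorem card_nearSet_le_of_gap {n : ℕ} [NeZero n] (w : ℕ) (S : Finset (ZMod n)) (g : ZMod n)
    (hg : ∀ t ∈ S, w ≤ (t - g).val) :
    #{π : Equiv.Perm (ZMod n) | S ⊆ nearSet w π} * n ^ #S ≤
      (9 * (w * (2 * w + 1))) ^ #S * n.factorial := by
  set F : (S → Fin w × Fin (2 * w + 1)) → Finset (Equiv.Perm (ZMod n)) := fun h =>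
    {π | ∀ t, ∀ ht : t ∈ S, π t = π (t - (((h ⟨t, ht⟩).1 : ℕ) + 1 : ℕ)) +
      ((((h ⟨t, ht⟩).2 : ℕ) : ZMod n) - (w : ZMod n))}
  have hsub : ({π : Equiv.Perm (ZMod n) | S ⊆ nearSet w π} : Finset _) ⊆ univ.biUnion F := by
    intro π hπ
    simp only [mem_filter, mem_univ, true_and] at hπ
    have : ∀ t : S, ∃ x : Fin w × Fin (2 * w + 1),
        π t = π (t - ((x.1 : ℕ) + 1 : ℕ)) + (((x.2 : ℕ) : ZMod n) - (w : ZMod n)) := by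
      intro t
      have := hπ t.2
      simp only [nearSet, mem_filter, mem_univ, true_and] at this
      obtain ⟨u, d, h⟩ := this
      exact ⟨(u, d), h⟩
    choose h hh using this
    simp only [mem_biUnion, mem_univ, true_and, F, mem_filter]
    exact ⟨h, fun t ht => hh ⟨t, ht⟩⟩
  have hF : ∀ h, #(F h) * n ^ #S ≤ 9 ^ #S * n.factorial := by
    intro h
    have := card_perm_recursive_le S
      (fun t => if ht : t ∈ S then t - (((h ⟨t, ht⟩).1 : ℕ) + 1 : ℕ) else t)
      (fun t => (t - g).val)
      (fun t x => if ht : t ∈ S then x + ((((h ⟨t, ht⟩).2 : ℕ) : ZMod n) - (w : ZMod n)) else x)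
      (by
        intro t ht
        simp only [ht, dif_pos]
        have h1 := hg t ht
        have h2 := (h ⟨t, ht⟩).1.2
        rw [sub_right_comm, ZMod.val_sub_natCast _ _ (by omega)]
        omega)
    rw [ZMod.card] at this
    refine le_trans ?_ this
    gcongr
    intro t ht
    simp only [F, mem_filter, mem_univ, true_and] at ht ⊢
    intro s hs
    simpa [hs] using ht s hs
  calc #{π : Equiv.Perm (ZMod n) | S ⊆ nearSet w π} * n ^ #S
      ≤ #(univ.biUnion F) * n ^ #S := by gcongr
    _ ≤ (∑ h, #(F h)) * n ^ #S := by gcongr; exact card_biUnion_le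
    _ = ∑ h, #(F h) * n ^ #S := by rw [sum_mul]
    _ ≤ ∑ _h : (S → Fin w × Fin (2 * w + 1)), 9 ^ #S * n.factorial := sum_le_sum fun h _ => hF h
    _ = _ := by simp [mul_pow]; ring

theorem card_nearSet_le {n : ℕ} [NeZero n] (w : ℕ) (hn : ∀ s, n ≤ s * w → n ^ w ≤ 2 ^ s)
    (S : Finset (ZMod n)) :
    #{π : Equiv.Perm (ZMod n) | S ⊆ nearSet w π} * n ^ #S ≤
      (18 * (w * (2 * w + 1))) ^ #S * n.factorial := by
  by_cases hS : ∃ g : ZMod n, ∀ t ∈ S, w ≤ (t - g).val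
  · obtain ⟨g, hg⟩ := hS
    refine (card_nearSet_le_of_gap w S g hg).trans ?_
    gcongr
    norm_num
  · push Not at hS
    have hcov : (univ : Finset (ZMod n)) ⊆
        (S ×ˢ range w).image fun x => x.1 - ((x.2 : ℕ) : ZMod n) := by
      intro g _
      obtain ⟨t, ht, h⟩ := hS g
      refine mem_image.2 ⟨(t, (t - g).val), by simp [ht, h], ?_⟩
      simp
    have hcard : n ≤ #S * w := by
      have := (card_le_card hcov).trans card_image_le
      simpa [ZMod.card] using this
    have hw : 0 < w := by
      rcases Nat.eq_zero_or_pos w with rfl | h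
      · have := NeZero.pos n
        simp at hcard
        omega
      · exact h
    set S' := S.filter fun t => w ≤ t.val
    have hS'S : S' ⊆ S := filter_subset _ _
    have hle : #S ≤ #S' + w := by
      have h1 : #(S \ S') ≤ #(range w) :=
        card_le_card_of_injOn ZMod.val
          (fun t ht => by
            obtain ⟨h1, h2⟩ := mem_sdiff.1 ht
            by_contra h
            exact h2 (mem_filter.2 ⟨h1, by simpa using h⟩))
          (ZMod.val_injective n).injOn
      rw [card_range, card_sdiff_of_subset hS'S] at h1
      omega
    have hlt := card_le_card hS'S
    have hmain := card_nearSet_le_of_gap w S' 0 (fun t ht => by simpa using (mem_filter.1 ht).2)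
    have hsub : #{π : Equiv.Perm (ZMod n) | S ⊆ nearSet w π} ≤
        #{π : Equiv.Perm (ZMod n) | S' ⊆ nearSet w π} := by
      gcongr
    calc #{π : Equiv.Perm (ZMod n) | S ⊆ nearSet w π} * n ^ #S
        ≤ #{π : Equiv.Perm (ZMod n) | S' ⊆ nearSet w π} * n ^ #S := by gcongr
      _ = #{π : Equiv.Perm (ZMod n) | S' ⊆ nearSet w π} * n ^ #S' * n ^ (#S - #S') := by
          rw [mul_assoc, ← pow_add]; congr 2; omega
      _ ≤ (9 * (w * (2 * w + 1))) ^ #S' * n.factorial * n ^ w := by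
          exact Nat.mul_le_mul hmain (Nat.pow_le_pow_right (NeZero.pos n) (by omega))
      _ ≤ (9 * (w * (2 * w + 1))) ^ #S * n.factorial * 2 ^ #S := by
          refine Nat.mul_le_mul (Nat.mul_le_mul_right _ ?_) (hn _ hcard)
          exact Nat.pow_le_pow_right (by positivity) hlt
      _ = (18 * (w * (2 * w + 1))) ^ #S * n.factorial := by
          rw [mul_right_comm, ← mul_pow]; congr 2; ring

/-- The element `t` follows, within distance `w`, an element of `T` or the start of `ℕ`. -/
def IsFollower (w : ℕ) (T : Finset ℕ) (t : ℕ) : Prop :=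
  t < w ∨ ∃ s ∈ T, s < t ∧ t ≤ s + w

/-- Number of steps from time `m` on during which an element would still be a follower. -/
def remaining (w m : ℕ) (T : Finset ℕ) : ℕ := (T.sup fun s => s + 1 + w - m) ⊔ (w - m)

theorem sum_powerset_range_follower_le (w : ℕ) (y c : ℝ) (hy : 0 ≤ y) (hc : 0 ≤ c)
    (hyw : 2 * y * w ≤ 1) (m : ℕ) :
    ∑ T ∈ (range m).powerset, (∏ t ∈ T, if IsFollower w T t then y else c) *
      (1 + 2 * y * remaining w m T) ≤ 2 * (1 + 2 * c) ^ m := by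
  induction m with
  | zero => simp [remaining]; linarith
  | succ m ih =>
    rw [range_add_one, sum_powerset_insert (by simp), ← sum_add_distrib, pow_succ, ← mul_assoc]
    refine le_trans ?_ (mul_le_mul_of_nonneg_right ih (by positivity))
    rw [sum_mul]
    refine sum_le_sum fun T hT => ?_
    rw [mem_powerset] at hT
    have hlt : ∀ s ∈ T, s < m := fun s hs => mem_range.1 (hT hs)
    have hmT : m ∉ T := fun h => lt_irrefl _ (hlt m h)
    have hcong : ∀ t, t ≤ m → (IsFollower w (insert m T) t ↔ IsFollower w T t) := by
      intro t ht
      simp only [IsFollower, mem_insert, exists_eq_or_imp]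
      constructor
      · rintro (h | h | h)
        · exact .inl h
        · omega
        · exact .inr h
      · rintro (h | h)
        · exact .inl h
        · exact .inr (.inr h)
    have hprod : (∏ t ∈ insert m T, if IsFollower w (insert m T) t then y else c) =
        (if IsFollower w T m then y else c) * ∏ t ∈ T, if IsFollower w T t then y else c := by
      rw [prod_insert hmT]
      simp only [hcong m le_rfl]
      congr 1
      refine prod_congr rfl fun t ht => ?_
      simp only [hcong t (hlt t ht).le]
    rw [hprod]
    set P := ∏ t ∈ T, if IsFollower w T t then y else c
    have hP : 0 ≤ P := prod_nonneg fun t _ => by split_ifs <;> assumption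
    have hr1 : remaining w (m + 1) T ≤ remaining w m T - 1 := by
      refine sup_le (Finset.sup_le fun s hs => ?_) ?_
      · have : s + 1 + w - m ≤ remaining w m T :=
          (le_sup (f := fun s => s + 1 + w - m) hs).trans le_sup_left
        omega
      · have : w - m ≤ remaining w m T := le_sup_right
        omega
    have hr2 : remaining w (m + 1) (insert m T) ≤ w := by
      refine sup_le (Finset.sup_le fun s hs => ?_) (by omega)
      rcases mem_insert.1 hs with rfl | hs
      · omega
      · have := hlt s hs
        omega
    have hr2' : (remaining w (m + 1) (insert m T) : ℝ) ≤ w := by exact_mod_cast hr2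
    have h2 : 1 + 2 * y * remaining w (m + 1) (insert m T) ≤ 2 := by
      have := mul_le_mul_of_nonneg_left hr2' (by positivity : 0 ≤ 2 * y)
      linarith
    have hstep : 1 + 2 * y * remaining w (m + 1) T + (if IsFollower w T m then y else c) * 2 ≤
        (1 + 2 * y * remaining w m T) * (1 + 2 * c) := by
      have hR : (0 : ℝ) ≤ remaining w m T := Nat.cast_nonneg _
      have hyR : 0 ≤ y * remaining w m T * c := by positivity
      split_ifs with hf
      · have hpos : 1 ≤ remaining w m T := by
          rcases hf with h | ⟨s, hs, h1, h3⟩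
          · have : w - m ≤ remaining w m T := le_sup_right
            omega
          · have : s + 1 + w - m ≤ remaining w m T :=
              (le_sup (f := fun s => s + 1 + w - m) hs).trans le_sup_left
            omega
        have : (remaining w (m + 1) T : ℝ) + 1 ≤ remaining w m T := by
          exact_mod_cast (by omega : remaining w (m + 1) T + 1 ≤ remaining w m T)
        have := mul_le_mul_of_nonneg_left this (by positivity : 0 ≤ 2 * y)
        linarith
      · have : (remaining w (m + 1) T : ℝ) ≤ remaining w m T := by
          exact_mod_cast (by omega : remaining w (m + 1) T ≤ remaining w m T)
        have := mul_le_mul_of_nonneg_left this (by positivity : 0 ≤ 2 * y)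
        linarith
    have hwt : 0 ≤ (if IsFollower w T m then y else c) := by split_ifs <;> assumption
    calc P * (1 + 2 * y * remaining w (m + 1) T) +
          (if IsFollower w T m then y else c) * P * (1 + 2 * y * remaining w (m + 1) (insert m T))
        ≤ P * (1 + 2 * y * remaining w (m + 1) T) +
          (if IsFollower w T m then y else c) * P * 2 := by gcongr
      _ = P * (1 + 2 * y * remaining w (m + 1) T +
          (if IsFollower w T m then y else c) * 2) := by ring
      _ ≤ P * ((1 + 2 * y * remaining w m T) * (1 + 2 * c)) := by gcongr
      _ = _ := by ring

/-- The elements of `T` that are preceded by another element of `T` within cyclic distance `w`. -/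
def followers {n : ℕ} (w : ℕ) (T : Finset (ZMod n)) : Finset (ZMod n) :=
  T.filter fun t => ∃ u : Fin w, t - ((u : ℕ) + 1 : ℕ) ∈ T

theorem sum_follower_weights_le {n : ℕ} [NeZero n] (w : ℕ) (y c : ℝ) (hc : 0 ≤ c) (hcy : c ≤ y)
    (hyw : 2 * y * w ≤ 1) :
    ∑ T : Finset (ZMod n), c ^ (#T - #(followers w T)) * y ^ #(followers w T) ≤
      2 * (1 + 2 * c) ^ n := by
  have hy := hc.trans hcy
  set F : Finset ℕ → ℝ := fun T => ∏ t ∈ T, if IsFollower w T t then y else c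
  have hF : ∀ T, 0 ≤ F T := fun T => prod_nonneg fun t _ => by split_ifs <;> assumption
  have hinj : Function.Injective (fun T : Finset (ZMod n) => T.image ZMod.val) :=
    Finset.image_injective (ZMod.val_injective n)
  have hT : ∀ T : Finset (ZMod n),
      c ^ (#T - #(followers w T)) * y ^ #(followers w T) ≤ F (T.image ZMod.val) := by
    intro T
    have h1 : c ^ (#T - #(followers w T)) * y ^ #(followers w T) =
        ∏ t ∈ T, if t ∈ followers w T then y else c := by
      have hsub : followers w T ⊆ T := filter_subset _ _
      rw [← card_sdiff_of_subset hsub, ← prod_sdiff hsub]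
      congr 1
      · rw [prod_congr rfl fun t ht => if_neg (mem_sdiff.1 ht).2, prod_const]
      · rw [prod_congr rfl fun t ht => if_pos ht, prod_const]
    rw [h1]
    simp only [F]
    rw [prod_image (ZMod.val_injective n).injOn]
    refine prod_le_prod (fun t _ => by split_ifs <;> assumption) fun t _ => ?_
    split_ifs with h2 h3 h3
    · exact le_rfl
    · refine absurd ?_ h3
      obtain ⟨-, u, hu⟩ := mem_filter.1 h2
      have hu2 := u.2
      by_cases htw : t.val < w
      · exact .inl htw
      · refine .inr ⟨_, mem_image_of_mem _ hu, ?_⟩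
        rw [ZMod.val_sub_natCast _ _ (by omega)]
        omega
    · exact hcy
    · exact le_rfl
  calc _ ≤ ∑ T : Finset (ZMod n), F (T.image ZMod.val) := sum_le_sum fun T _ => hT T
    _ = ∑ T ∈ univ.image (fun T : Finset (ZMod n) => T.image ZMod.val), F T := by
        rw [sum_image hinj.injOn]
    _ ≤ ∑ T ∈ (range n).powerset, F T := by
        refine sum_le_sum_of_subset_of_nonneg ?_ fun T _ _ => hF T
        intro T h
        obtain ⟨S, -, rfl⟩ := mem_image.1 h
        refine mem_powerset.2 fun t ht => ?_
        obtain ⟨s, -, rfl⟩ := mem_image.1 ht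
        exact mem_range.2 s.val_lt
    _ ≤ ∑ T ∈ (range n).powerset, F T * (1 + 2 * y * remaining w n T) := by
        refine sum_le_sum fun T _ => le_mul_of_one_le_right (hF T) ?_
        have : 0 ≤ 2 * y * remaining w n T := by positivity
        linarith
    _ ≤ _ := sum_powerset_range_follower_le w y c hy hc hyw n

theorem eventually_pow_le_two_pow (w : ℕ) :
    ∀ᶠ n : ℕ in Filter.atTop, ∀ s, n ≤ s * w → n ^ w ≤ 2 ^ s := by
  rcases Nat.eq_zero_or_pos w with rfl | hw
  · filter_upwards with n s _
    simpa using Nat.one_le_two_pow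
  have h := tendsto_pow_const_div_const_pow_of_one_lt (w * w) (by norm_num : (1 : ℝ) < 2)
  filter_upwards [h.eventually (gt_mem_nhds one_pos)] with n hn s hs
  rw [div_lt_one (by positivity)] at hn
  have h1 : n ^ (w * w) ≤ 2 ^ n := by exact_mod_cast hn.le
  have h2 : (n ^ w) ^ w ≤ (2 ^ s) ^ w := by
    rw [← pow_mul, ← pow_mul]
    exact h1.trans (Nat.pow_le_pow_right (by norm_num) hs)
  exact (Nat.pow_le_pow_iff_left hw.ne').1 h2

theorem sum_pow_card_followers_nearSet_le (w : ℕ) (ε : ℝ) (hε : 0 < ε) :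
    ∃ x : ℝ, 0 < x ∧ ∀ᶠ n : ℕ in Filter.atTop, ∀ [NeZero n], ∀ L : ℝ, 1 ≤ L → L ≤ x * n →
      ∑ π : Equiv.Perm (ZMod n), L ^ #(followers w (nearSet w π)) ≤ (1 + ε) * n.factorial := by
  set K₀ : ℕ := 18 * (w * (2 * w + 1))
  set K : ℝ := (K₀ : ℝ) + 1
  have hK : 0 < K := by positivity
  set y : ℝ := min (ε / (2 * Real.exp (2 * K))) (1 / (2 * (w + 1)))
  have hy : 0 < y := lt_min (by positivity) (by positivity)
  have hy1 : y ≤ ε / (2 * Real.exp (2 * K)) := min_le_left _ _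
  have hy2 : y ≤ 1 / (2 * (w + 1)) := min_le_right _ _
  have hyw : 2 * y * w ≤ 1 := by
    rw [le_div_iff₀ (by positivity)] at hy2
    nlinarith
  refine ⟨y ^ 2 / K, by positivity, ?_⟩
  filter_upwards [eventually_pow_le_two_pow w, Filter.eventually_gt_atTop 0,
    Filter.eventually_ge_atTop ⌈K / y⌉₊] with n hn hn0 hnK _ L hL hLx
  have hnR : (0 : ℝ) < n := by exact_mod_cast hn0
  set c : ℝ := K / n
  have hc : 0 < c := by positivity
  have hcy : c ≤ y := by
    have : K / y ≤ n := Nat.ceil_le.1 hnK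
    rw [div_le_iff₀ hy] at this
    rw [div_le_iff₀ hnR]
    linarith
  have hcL : c * L ≤ y ^ 2 := by
    calc c * L ≤ c * (y ^ 2 / K * n) := by gcongr
      _ = y ^ 2 := by simp only [c]; field_simp
  have hy_one : y ≤ 1 := by
    refine hy2.trans ?_
    rw [div_le_one (by positivity)]
    have : (0 : ℝ) ≤ w := Nat.cast_nonneg _
    linarith
  have hprob : ∀ T : Finset (ZMod n),
      (#{π : Equiv.Perm (ZMod n) | T ⊆ nearSet w π} : ℝ) ≤ c ^ #T * n.factorial := by
    intro T
    have h1 : (#{π : Equiv.Perm (ZMod n) | T ⊆ nearSet w π} : ℝ) * n ^ #T ≤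
        (K₀ : ℝ) ^ #T * n.factorial := by exact_mod_cast card_nearSet_le w hn T
    simp only [c]
    rw [div_pow, div_mul_eq_mul_div, le_div_iff₀ (by positivity)]
    refine h1.trans ?_
    gcongr
    simp [K]
  have hterm : ∀ T : Finset (ZMod n), (followers w T).Nonempty →
      c ^ #T * L ^ #(followers w T) ≤
        y * (c ^ (#T - #(followers w T)) * y ^ #(followers w T)) := by
    intro T hT
    set j := #(followers w T)
    have hj : j ≤ #T := card_le_card (filter_subset _ _)
    have hj1 : 1 ≤ j := hT.card_pos
    calc c ^ #T * L ^ j = c ^ (#T - j) * (c * L) ^ j := by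
          rw [mul_pow, ← mul_assoc, ← pow_add, Nat.sub_add_cancel hj]
      _ ≤ c ^ (#T - j) * (y ^ 2) ^ j := by gcongr
      _ = c ^ (#T - j) * (y ^ j * y ^ j) := by rw [← pow_mul, mul_comm 2 j, pow_mul, sq]
      _ ≤ c ^ (#T - j) * (y ^ 1 * y ^ j) := by
          gcongr ?_ * (?_ * ?_)
          exact pow_le_pow_of_le_one hy.le hy_one hj1
      _ = _ := by ring
  set 𝒯 : Finset (Finset (ZMod n)) := univ.filter fun T => (followers w T).Nonempty
  have hpt : ∀ π : Equiv.Perm (ZMod n), L ^ #(followers w (nearSet w π)) ≤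
      1 + ∑ T ∈ 𝒯, if T ⊆ nearSet w π then L ^ #(followers w T) else 0 := by
    intro π
    have hnn : ∀ T ∈ 𝒯, 0 ≤ (if T ⊆ nearSet w π then L ^ #(followers w T) else 0) := by
      intro T _
      split_ifs <;> positivity
    by_cases h : (followers w (nearSet w π)).Nonempty
    · have := single_le_sum hnn (mem_filter.2 ⟨mem_univ (nearSet w π), h⟩)
      rw [if_pos subset_rfl] at this
      linarith
    · rw [not_nonempty_iff_eq_empty.1 h]
      simpa using sum_nonneg hnn
  have hfin : y * (2 * (1 + 2 * c) ^ n) ≤ ε := by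
    have h1 : (1 + 2 * c) ^ n ≤ Real.exp (2 * K) := by
      calc (1 + 2 * c) ^ n ≤ (Real.exp (2 * c)) ^ n := by
            gcongr
            linarith [Real.add_one_le_exp (2 * c)]
        _ = Real.exp (2 * K) := by
            rw [← Real.exp_nat_mul]; congr 1; simp only [c]; field_simp
    rw [le_div_iff₀ (by positivity)] at hy1
    calc y * (2 * (1 + 2 * c) ^ n) ≤ y * (2 * Real.exp (2 * K)) := by gcongr
      _ ≤ ε := hy1
  have hcardperm : Fintype.card (Equiv.Perm (ZMod n)) = n.factorial := by
    rw [Fintype.card_perm, ZMod.card]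
  calc ∑ π : Equiv.Perm (ZMod n), L ^ #(followers w (nearSet w π))
      ≤ ∑ π : Equiv.Perm (ZMod n),
          (1 + ∑ T ∈ 𝒯, if T ⊆ nearSet w π then L ^ #(followers w T) else 0) :=
        sum_le_sum fun π _ => hpt π
    _ = n.factorial + ∑ T ∈ 𝒯,
          (#{π : Equiv.Perm (ZMod n) | T ⊆ nearSet w π} : ℝ) * L ^ #(followers w T) := by
        rw [sum_add_distrib, sum_comm]
        congr 1
        · simp [hcardperm]
        · refine sum_congr rfl fun T _ => ?_
          rw [← sum_filter, sum_const, nsmul_eq_mul]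
    _ ≤ n.factorial + ∑ T ∈ 𝒯, n.factorial *
          (y * (c ^ (#T - #(followers w T)) * y ^ #(followers w T))) := by
        refine add_le_add le_rfl (sum_le_sum fun T hT => ?_)
        calc _ ≤ c ^ #T * n.factorial * L ^ #(followers w T) := by gcongr; exact hprob T
          _ = n.factorial * (c ^ #T * L ^ #(followers w T)) := by ring
          _ ≤ _ := mul_le_mul_of_nonneg_left (hterm T (mem_filter.1 hT).2) (Nat.cast_nonneg _)
    _ ≤ n.factorial + ∑ T : Finset (ZMod n), n.factorial *
          (y * (c ^ (#T - #(followers w T)) * y ^ #(followers w T))) := by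
        gcongr
        exact subset_univ _
    _ ≤ n.factorial + n.factorial * (y * (2 * (1 + 2 * c) ^ n)) := by
        rw [← mul_sum, ← mul_sum]
        gcongr
        exact sum_follower_weights_le w y c hc.le hcy hyw
    _ ≤ n.factorial + n.factorial * ε := by gcongr
    _ = _ := by ring

/-- The `r`-sets contained in `l` cyclically consecutive elements of `ZMod n`. -/
def cycEdges (r l n : ℕ) [NeZero n] : Finset (Finset (ZMod n)) :=
  univ.filter fun e => #e = r ∧ ∃ i : ZMod n, e ⊆ (range l).image fun j : ℕ => i + (j : ZMod n)

theorem card_cycEdges_inter_le {n : ℕ} [NeZero n] (r w : ℕ) (hr : 3 ≤ r)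
    (π : Equiv.Perm (ZMod n)) :
    #{e ∈ cycEdges r (w + 1) n | e.image π ∈ cycEdges r (w + 1) n} ≤
      w.choose (r - 1) * #(followers w (nearSet w π)) := by
  have hsub : ({e ∈ cycEdges r (w + 1) n | e.image π ∈ cycEdges r (w + 1) n} : Finset _) ⊆
      (followers w (nearSet w π) ×ˢ powersetCard (r - 1) (range w)).image
        fun x => insert x.1 (x.2.image fun j : ℕ => x.1 - ((j + 1 : ℕ) : ZMod n)) := by
    intro e he
    simp only [cycEdges, mem_filter, mem_univ, true_and] at he
    obtain ⟨⟨hcard, i, hi⟩, -, i', hi'⟩ := he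
    set J₀ := (range (w + 1)).filter fun j : ℕ => i + (j : ZMod n) ∈ e
    have hne : J₀.Nonempty := by
      obtain ⟨s, hs⟩ := card_pos.1 (by omega : 0 < #e)
      obtain ⟨j, hj, rfl⟩ := mem_image.1 (hi hs)
      exact ⟨j, mem_filter.2 ⟨hj, hs⟩⟩
    set m := J₀.max' hne
    obtain ⟨hmw, ht⟩ := mem_filter.1 (J₀.max'_mem hne)
    rw [mem_range] at hmw
    set t : ZMod n := i + (m : ZMod n)
    change t ∈ e at ht
    have hpred : ∀ s : ZMod n, ∃ j, s ∈ e.erase t → j < w ∧ s = t - ((j + 1 : ℕ) : ZMod n) := by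
      intro s
      by_cases hs : s ∈ e.erase t
      · obtain ⟨hst, hse⟩ := mem_erase.1 hs
        obtain ⟨j, hj, hjs⟩ := mem_image.1 (hi hse)
        subst hjs
        have hjm : j ≤ m := J₀.le_max' j (mem_filter.2 ⟨hj, hse⟩)
        have hjm' : j ≠ m := fun h => hst (by rw [h])
        refine ⟨m - j - 1, fun _ => ⟨by omega, ?_⟩⟩
        have : m - j - 1 + 1 = m - j := by omega
        rw [this, Nat.cast_sub hjm]
        simp only [t]
        ring
      · exact ⟨0, fun h => absurd h hs⟩
    choose j hj using hpred
    have hjinj : Set.InjOn j (e.erase t : Finset (ZMod n)) := by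
      intro s hs s' hs' h
      rw [(hj s hs).2, (hj s' hs').2, h]
    have hcJ : #((e.erase t).image j) = r - 1 := by
      rw [card_image_of_injOn hjinj, card_erase_of_mem ht, hcard]
    have hnear : ∀ a ∈ e, ∀ b ∈ e, ∀ u < w, b = a - ((u + 1 : ℕ) : ZMod n) →
        a ∈ nearSet w π := by
      intro a ha b hb u hu hab
      obtain ⟨x, hx, hx'⟩ := mem_image.1 (hi' (mem_image_of_mem π ha))
      obtain ⟨z, hz, hz'⟩ := mem_image.1 (hi' (mem_image_of_mem π hb))
      rw [mem_range] at hx hz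
      refine mem_filter.2 ⟨mem_univ _, ⟨u, hu⟩, ⟨x + w - z, by omega⟩, ?_⟩
      change π a = π (a - ((u + 1 : ℕ) : ZMod n)) + (((x + w - z : ℕ) : ZMod n) - (w : ZMod n))
      rw [← hab, ← hx', ← hz', Nat.cast_sub (by omega), Nat.cast_add]
      ring
    have hpair : ∃ a ∈ e.erase t, ∃ b ∈ e.erase t, j a < j b := by
      obtain ⟨a, ha, b, hb, hab⟩ := one_lt_card.1
        (by rw [card_erase_of_mem ht]; omega : 1 < #(e.erase t))
      rcases lt_trichotomy (j a) (j b) with h | h | h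
      · exact ⟨a, ha, b, hb, h⟩
      · exact absurd (hjinj ha hb h) hab
      · exact ⟨b, hb, a, ha, h⟩
    obtain ⟨a, ha, b, hb, hab⟩ := hpair
    have haj := hj a ha
    have hbj := hj b hb
    refine mem_image.2 ⟨(t, (e.erase t).image j), mem_product.2 ⟨?_, ?_⟩, ?_⟩
    · refine mem_filter.2 ⟨hnear t ht a (mem_of_mem_erase ha) (j a) haj.1 haj.2,
        ⟨j a, haj.1⟩, ?_⟩
      change t - ((j a + 1 : ℕ) : ZMod n) ∈ nearSet w π
      rw [← haj.2]
      refine hnear a (mem_of_mem_erase ha) b (mem_of_mem_erase hb) (j b - j a - 1) (by omega) ?_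
      have h1 : j b - j a - 1 + 1 = j b - j a := by omega
      rw [h1, Nat.cast_sub hab.le]
      have e1 := haj.2
      have e2 := hbj.2
      push_cast at e1 e2
      linear_combination e2 - e1
    · refine mem_powersetCard.2 ⟨fun x hx => ?_, hcJ⟩
      obtain ⟨s, hs, rfl⟩ := mem_image.1 hx
      exact mem_range.2 (hj s hs).1
    · simp only
      rw [image_image]
      conv_rhs => rw [← insert_erase ht]
      congr 1
      conv_rhs => rw [← image_id (s := e.erase t)]
      exact image_congr fun s hs => (hj s hs).2.symm
  refine (card_le_card hsub).trans (card_image_le.trans ?_)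
  rw [card_product, card_powersetCard, card_range, mul_comm]

theorem cycWindow_eq_image_range (k r n : ℕ) (σ : ZMod n → Fin n) (i : ZMod n) :
    cycWindow k r n σ i = (range (k + r - 1)).image fun j : ℕ => σ (i + (j : ZMod n)) := by
  ext x
  simp [cycWindow, Finset.bind_def]

theorem hamPowEdges_eq_image {n : ℕ} [NeZero n] (r k : ℕ) (σ : ZMod n → Fin n)
    (hσ : Function.Bijective σ) :
    hamPowEdges r k n σ = (cycEdges r (k + r - 1) n).image (image σ) := by
  ext e
  simp only [hamPowEdges, cycEdges, mem_filter, mem_univ, true_and, mem_image]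
  have hwin : ∀ i, cycWindow k r n σ i =
      ((range (k + r - 1)).image fun j : ℕ => i + (j : ZMod n)).image σ := by
    intro i
    rw [cycWindow_eq_image_range, image_image]
    rfl
  constructor
  · rintro ⟨hc, i, hi⟩
    rw [hwin] at hi
    obtain ⟨f, hf, rfl⟩ := subset_image_iff.1 hi
    rw [card_image_of_injective _ hσ.1] at hc
    exact ⟨f, ⟨hc, i, hf⟩, rfl⟩
  · rintro ⟨f, ⟨hc, i, hi⟩, rfl⟩
    refine ⟨by rwa [card_image_of_injective _ hσ.1], i, ?_⟩
    rw [hwin]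
    exact image_subset_image hi

theorem card_hamPowEdges {n : ℕ} [NeZero n] (r k : ℕ) (σ : ZMod n → Fin n)
    (hσ : Function.Bijective σ) :
    #(hamPowEdges r k n σ) = #(cycEdges r (k + r - 1) n) := by
  rw [hamPowEdges_eq_image r k σ hσ, card_image_of_injective _ (Finset.image_injective hσ.1)]

theorem card_hamPowEdges_union_add {n : ℕ} [NeZero n] (r k : ℕ) (σ : ZMod n → Fin n)
    (hσ : Function.Bijective σ) (π : Equiv.Perm (ZMod n)) :
    #(hamPowEdges r k n σ ∪ hamPowEdges r k n (σ ∘ π)) +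
      #{e ∈ cycEdges r (k + r - 1) n | e.image π ∈ cycEdges r (k + r - 1) n} =
      2 * #(cycEdges r (k + r - 1) n) := by
  set G := cycEdges r (k + r - 1) n
  have hinjσ : Function.Injective (image σ) := Finset.image_injective hσ.1
  have hinjπ : Function.Injective (image π) := Finset.image_injective π.injective
  have h1 : hamPowEdges r k n (σ ∘ π) = (G.image (image π)).image (image σ) := by
    rw [hamPowEdges_eq_image r k _ (hσ.comp π.bijective), image_image]
    congr 1
    ext1 e
    simp [image_image]
  have h2 : G ∩ G.image (image π) = {e ∈ G | e.image π ∈ G}.image (image π) := by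
    ext e
    simp only [mem_inter, mem_image, mem_filter]
    constructor
    · rintro ⟨h, f, hf, rfl⟩
      exact ⟨f, ⟨hf, h⟩, rfl⟩
    · rintro ⟨f, ⟨hf, h⟩, rfl⟩
      exact ⟨h, f, hf, rfl⟩
  rw [h1, hamPowEdges_eq_image r k σ hσ, ← image_union, card_image_of_injective _ hinjσ,
    ← card_image_of_injective {e ∈ G | e.image π ∈ G} hinjπ, ← h2, card_union_add_card_inter,
    card_image_of_injective _ hinjπ, two_mul]

theorem sum_prW_of_subset (n r : ℕ) (p : ℝ) (A : Finset (Finset (Fin n))) (hA : A ⊆ rSets n r) :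
    ∑ H ∈ (rSets n r).powerset, prW n r p H * (if A ⊆ H then 1 else 0) = p ^ #A := by
  set s := rSets n r
  simp only [mul_ite, mul_one, mul_zero]
  rw [← sum_filter]
  have h1 : s.powerset.filter (A ⊆ ·) = (s \ A).powerset.image (A ∪ ·) := by
    rw [← Finset.Icc_eq_image_powerset hA]
    ext H
    simp [and_comm]
  rw [h1, sum_image]
  · have h2 : ∀ B ∈ (s \ A).powerset, prW n r p (A ∪ B) =
        p ^ #A * (p ^ #B * (1 - p) ^ (#(s \ A) - #B)) := by
      intro B hB
      rw [mem_powerset] at hB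
      have hd : Disjoint A B := disjoint_sdiff.mono_right hB
      rw [prW, card_union_of_disjoint hd, pow_add, card_sdiff_of_subset hA, mul_assoc,
        Nat.sub_sub]
    rw [sum_congr rfl h2, ← mul_sum, sum_pow_mul_eq_add_pow]
    simp
  · intro B hB B' hB' h
    simp only [coe_powerset, Set.mem_preimage, Set.mem_powerset_iff, coe_subset] at hB hB'
    have hd : Disjoint A B := disjoint_sdiff.mono_right hB
    have hd' : Disjoint A B' := disjoint_sdiff.mono_right hB'
    have := congrArg (· \ A) h
    simpa [union_sdiff_left, sdiff_eq_self_of_disjoint hd.symm,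
      sdiff_eq_self_of_disjoint hd'.symm] using this

theorem hamPowEdges_subset_rSets (r k n : ℕ) (σ : ZMod n → Fin n) :
    hamPowEdges r k n σ ⊆ rSets n r := fun _ he =>
  mem_filter.2 ⟨mem_univ _, (mem_filter.1 he).2.1⟩

theorem XH_eq_sum {n : ℕ} [NeZero n] (r k : ℕ) (H : Finset (Finset (Fin n))) :
    XH r k n H =
      ∑ σ ∈ univ.filter (IsCycRep n), if hamPowEdges r k n σ ⊆ H then (1 : ℝ) else 0 := by
  rw [XH, Nat.card_eq_fintype_card, Fintype.card_subtype, sum_boole, filter_filter]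

theorem expct_XH {n : ℕ} [NeZero n] (r k : ℕ) (p : ℝ) :
    expct n r p (XH r k n) = ∑ σ ∈ univ.filter (IsCycRep n), p ^ #(hamPowEdges r k n σ) := by
  simp only [expct, XH_eq_sum, mul_sum]
  rw [sum_comm]
  exact sum_congr rfl fun σ _ => sum_prW_of_subset n r p _ (hamPowEdges_subset_rSets r k n σ)

theorem expct_XH_sq {n : ℕ} [NeZero n] (r k : ℕ) (p : ℝ) :
    expct n r p (fun H => XH r k n H ^ 2) =
      ∑ σ ∈ univ.filter (IsCycRep n), ∑ τ ∈ univ.filter (IsCycRep n),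
        p ^ #(hamPowEdges r k n σ ∪ hamPowEdges r k n τ) := by
  simp only [expct, XH_eq_sum, sq, sum_mul_sum]
  simp only [mul_sum]
  rw [sum_comm]
  refine sum_congr rfl fun σ _ => ?_
  rw [sum_comm]
  refine sum_congr rfl fun τ _ => ?_
  rw [← sum_prW_of_subset n r p _ (union_subset (hamPowEdges_subset_rSets r k n σ)
    (hamPowEdges_subset_rSets r k n τ))]
  refine sum_congr rfl fun H _ => ?_
  simp only [union_subset_iff, ite_and, mul_ite, mul_one, mul_zero]
  split_ifs <;> simp

/-- The symmetries `x ↦ a + x` and `x ↦ a - x` of the cyclic group. -/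
def dihedralPerm {n : ℕ} (g : ZMod n × Bool) : Equiv.Perm (ZMod n) :=
  if g.2 then Equiv.addLeft g.1 else Equiv.subLeft g.1

theorem cycWindow_comp_addLeft (r k n : ℕ) (σ : ZMod n → Fin n) (a i : ZMod n) :
    cycWindow k r n (σ ∘ Equiv.addLeft a) i = cycWindow k r n σ (a + i) := by
  simp [cycWindow_eq_image_range, add_assoc]

theorem cycWindow_comp_subLeft (r k n : ℕ) (σ : ZMod n → Fin n) (a i : ZMod n) :
    cycWindow k r n (σ ∘ Equiv.subLeft a) i =
      cycWindow k r n σ (a - i - ((k + r - 1 - 1 : ℕ) : ZMod n)) := by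
  ext x
  simp only [cycWindow_eq_image_range, mem_image, mem_range, Function.comp_apply, Equiv.subLeft_apply]
  constructor
  all_goals
    rintro ⟨j, hj, rfl⟩
    refine ⟨k + r - 1 - 1 - j, by omega, congrArg σ ?_⟩
    rw [Nat.cast_sub (n := k + r - 1 - 1) (by omega)]
    ring

theorem hamPowEdges_comp_dihedralPerm (r k n : ℕ) (σ : ZMod n → Fin n) (g : ZMod n × Bool) :
    hamPowEdges r k n (σ ∘ dihedralPerm g) = hamPowEdges r k n σ := by
  obtain ⟨a, s⟩ := g
  unfold hamPowEdges
  refine filter_congr fun e _ => and_congr_right fun _ => ?_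
  cases s
  · simp only [dihedralPerm, Bool.false_eq_true, if_false, cycWindow_comp_subLeft]
    exact ⟨fun ⟨i, hi⟩ => ⟨_, hi⟩, fun ⟨i, hi⟩ =>
      ⟨a - ((k + r - 1 - 1 : ℕ) : ZMod n) - i, by convert hi using 2; ring⟩⟩
  · simp only [dihedralPerm, if_true, cycWindow_comp_addLeft]
    exact ⟨fun ⟨i, hi⟩ => ⟨_, hi⟩, fun ⟨i, hi⟩ => ⟨i - a, by simpa using hi⟩⟩

theorem existsUnique_dihedralPerm_isCycRep {n : ℕ} (hn : 3 ≤ n) (σ : ZMod n → Fin n)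
    (hσ : Function.Bijective σ) : ∃! g, IsCycRep n (σ ∘ dihedralPerm g) := by
  obtain ⟨a, ha⟩ := hσ.2 ⟨0, by omega⟩
  have hval : ∀ b, (σ b).val = 0 ↔ b = a := by
    intro b
    rw [← hσ.1.eq_iff, ha, Fin.ext_iff]
  have hne : (σ (a + 1)).val ≠ (σ (a - 1)).val := by
    intro h
    have h1 := hσ.1 (Fin.ext h)
    have h2 : ((2 : ℕ) : ZMod n) = 0 := by
      push_cast
      linear_combination h1
    rw [ZMod.natCast_eq_zero_iff] at h2
    exact absurd (Nat.le_of_dvd (by norm_num) h2) (by omega)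
  have hiff : ∀ g : ZMod n × Bool, IsCycRep n (σ ∘ dihedralPerm g) ↔
      g = (a, decide ((σ (a + 1)).val < (σ (a - 1)).val)) := by
    rintro ⟨b, s⟩
    have hb : Function.Bijective (σ ∘ dihedralPerm (b, s)) := hσ.comp (Equiv.bijective _)
    cases s
    · rw [IsCycRep, and_iff_right hb]
      simp only [dihedralPerm, Function.comp_apply, Bool.false_eq_true,
        if_false, Equiv.subLeft_apply, sub_zero, hval, sub_neg_eq_add, Prod.mk.injEq]
      refine and_congr_right fun h => ?_
      subst h
      simp only [eq_comm (a := false), decide_eq_false_iff_not]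
      omega
    · rw [IsCycRep, and_iff_right hb]
      simp only [dihedralPerm, Function.comp_apply,
        if_true, Equiv.coe_addLeft, add_zero, hval, ← sub_eq_add_neg, Prod.mk.injEq]
      refine and_congr_right fun h => ?_
      subst h
      simp only [eq_comm (a := true), decide_eq_true_eq]
  exact ⟨_, (hiff _).2 rfl, fun g hg => (hiff g).1 hg⟩

theorem sum_bijective_hamPowEdges {n : ℕ} [NeZero n] (hn : 3 ≤ n) (r k : ℕ)
    (F : Finset (Finset (Fin n)) → ℝ) :
    ∑ σ ∈ univ.filter (Function.Bijective : (ZMod n → Fin n) → Prop), F (hamPowEdges r k n σ) =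
      2 * n * ∑ σ ∈ univ.filter (IsCycRep n), F (hamPowEdges r k n σ) := by
  have h1 : ∀ σ ∈ univ.filter (Function.Bijective : (ZMod n → Fin n) → Prop),
      F (hamPowEdges r k n σ) = ∑ g, if IsCycRep n (σ ∘ dihedralPerm g) then
        F (hamPowEdges r k n (σ ∘ dihedralPerm g)) else 0 := by
    intro σ hσ
    obtain ⟨g, hg, huniq⟩ := existsUnique_dihedralPerm_isCycRep hn σ (mem_filter.1 hσ).2
    rw [sum_eq_single g, if_pos hg, hamPowEdges_comp_dihedralPerm]
    · intro g' _ h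
      exact if_neg fun h' => h (huniq g' h')
    · simp
  rw [sum_congr rfl h1, sum_comm]
  have h2 : ∀ g : ZMod n × Bool,
      (∑ σ ∈ univ.filter (Function.Bijective : (ZMod n → Fin n) → Prop),
        if IsCycRep n (σ ∘ dihedralPerm g) then
          F (hamPowEdges r k n (σ ∘ dihedralPerm g)) else 0) =
        ∑ σ ∈ univ.filter (IsCycRep n), F (hamPowEdges r k n σ) := by
    intro g
    rw [← sum_filter, filter_filter]
    refine sum_equiv (Equiv.arrowCongr (dihedralPerm g).symm (Equiv.refl _)) ?_ ?_
    · intro σ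
      simp only [mem_filter, mem_univ, true_and]
      change _ ↔ IsCycRep n (σ ∘ dihedralPerm g)
      refine ⟨fun h => h.2, fun h => ⟨?_, h⟩⟩
      exact ((dihedralPerm g).bijective.of_comp_iff σ).1 h.1
    · intro σ _
      rfl
  rw [sum_congr rfl fun g _ => h2 g]
  rw [sum_const, nsmul_eq_mul, card_univ, Fintype.card_prod, ZMod.card, Fintype.card_bool]
  push_cast
  ring

theorem sum_bijective_eq_sum_perm {n : ℕ} [NeZero n] (σ : ZMod n → Fin n)
    (hσ : Function.Bijective σ) (F : (ZMod n → Fin n) → ℝ) :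
    ∑ τ ∈ univ.filter (Function.Bijective : (ZMod n → Fin n) → Prop), F τ =
      ∑ π : Equiv.Perm (ZMod n), F (σ ∘ π) := by
  symm
  refine sum_bij (fun π _ => σ ∘ π) ?_ ?_ ?_ fun _ _ => rfl
  · intro π _
    exact mem_filter.2 ⟨mem_univ _, hσ.comp π.bijective⟩
  · intro π _ ρ _ h
    ext1 x
    exact hσ.1 (congrFun h x)
  · intro τ hτ
    have hτ := (mem_filter.1 hτ).2
    refine ⟨(Equiv.ofBijective τ hτ).trans (Equiv.ofBijective σ hσ).symm, mem_univ _, ?_⟩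
    ext1 x
    exact (Equiv.ofBijective σ hσ).apply_symm_apply (τ x)

theorem card_filter_bijective {n : ℕ} [NeZero n] :
    #(univ.filter (Function.Bijective : (ZMod n → Fin n) → Prop)) = n.factorial := by
  have e : ZMod n ≃ Fin n := Fintype.equivOfCardEq (by simp [ZMod.card])
  have := sum_bijective_eq_sum_perm e e.bijective fun _ => 1
  simp only [sum_const, nsmul_eq_mul, mul_one, card_univ, Fintype.card_perm, ZMod.card] at this
  exact_mod_cast this

/-- Comparison of the second moment with the squared first moment, given a bound for the
average of `p⁻¹` to the number of shared edges. -/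
theorem expct_XH_sq_le {n : ℕ} [NeZero n] (hn : 3 ≤ n) (r k : ℕ) (hr : 3 ≤ r) (p ε : ℝ)
    (hp : 0 < p) (hp1 : p ≤ 1)
    (h : ∑ π : Equiv.Perm (ZMod n), ((p⁻¹) ^ (k + r - 2).choose (r - 1)) ^
      #(followers (k + r - 2) (nearSet (k + r - 2) π)) ≤ (1 + ε) * n.factorial) :
    expct n r p (fun H => XH r k n H ^ 2) ≤ (1 + ε) * expct n r p (XH r k n) ^ 2 := by
  set G := cycEdges r (k + r - 1) n with hG
  set B := univ.filter (Function.Bijective : (ZMod n → Fin n) → Prop)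
  have hnR : (0 : ℝ) < n := by exact_mod_cast NeZero.pos n
  have hfirst : 2 * n * expct n r p (XH r k n) = n.factorial * p ^ #G := by
    rw [expct_XH, ← sum_bijective_hamPowEdges hn r k (fun E => p ^ #E),
      sum_congr rfl fun σ hσ => by rw [card_hamPowEdges r k σ (mem_filter.1 hσ).2], sum_const,
      card_filter_bijective, nsmul_eq_mul]
  have hsecond : (2 * n) * (2 * n * expct n r p (fun H => XH r k n H ^ 2)) =
      ∑ σ ∈ B, ∑ τ ∈ B, p ^ #(hamPowEdges r k n σ ∪ hamPowEdges r k n τ) := by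
    have h1 : ∀ σ : ZMod n → Fin n,
        ∑ τ ∈ B, p ^ #(hamPowEdges r k n σ ∪ hamPowEdges r k n τ) =
        2 * n * ∑ τ ∈ univ.filter (IsCycRep n),
          p ^ #(hamPowEdges r k n σ ∪ hamPowEdges r k n τ) := fun σ =>
      sum_bijective_hamPowEdges hn r k fun E => p ^ #(hamPowEdges r k n σ ∪ E)
    simp only [h1]
    rw [expct_XH_sq, ← mul_sum]
    congr 1
    exact (sum_bijective_hamPowEdges hn r k fun E =>
      ∑ τ ∈ univ.filter (IsCycRep n), p ^ #(E ∪ hamPowEdges r k n τ)).symm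
  have hinner : ∀ σ ∈ B, ∑ τ ∈ B, p ^ #(hamPowEdges r k n σ ∪ hamPowEdges r k n τ) ≤
      p ^ (2 * #G) * ((1 + ε) * n.factorial) := by
    intro σ hσ
    have hσ := (mem_filter.1 hσ).2
    rw [sum_bijective_eq_sum_perm σ hσ
      (fun τ => p ^ #(hamPowEdges r k n σ ∪ hamPowEdges r k n τ))]
    refine le_trans ?_ (mul_le_mul_of_nonneg_left h (by positivity))
    rw [mul_sum]
    refine sum_le_sum fun π _ => ?_
    have hu := card_hamPowEdges_union_add r k σ hσ π
    have hb := card_cycEdges_inter_le r (k + r - 2) hr π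
    rw [show k + r - 2 + 1 = k + r - 1 by omega] at hb
    rw [← hG] at hu hb
    rw [← hu, pow_add, mul_assoc]
    refine le_mul_of_one_le_right (by positivity) ?_
    rw [← pow_mul]
    calc (1 : ℝ) = p ^ #{e ∈ G | e.image π ∈ G} * p⁻¹ ^ #{e ∈ G | e.image π ∈ G} := by
          rw [← mul_pow, mul_inv_cancel₀ hp.ne', one_pow]
      _ ≤ _ := by
          gcongr
          exact (one_le_inv₀ hp).2 hp1
  have hsum : (2 * n) * (2 * n * expct n r p (fun H => XH r k n H ^ 2)) ≤
      n.factorial * (p ^ (2 * #G) * ((1 + ε) * n.factorial)) := by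
    rw [hsecond]
    refine (sum_le_sum hinner).trans (le_of_eq ?_)
    rw [sum_const, card_filter_bijective, nsmul_eq_mul]
  refine le_of_mul_le_mul_left ?_ (by positivity : (0 : ℝ) < (2 * n) * (2 * n))
  calc (2 * n) * (2 * n) * expct n r p (fun H => XH r k n H ^ 2)
      = (2 * n) * (2 * n * expct n r p (fun H => XH r k n H ^ 2)) := by ring
    _ ≤ n.factorial * (p ^ (2 * #G) * ((1 + ε) * n.factorial)) := hsum
    _ = (1 + ε) * (n.factorial * p ^ #G) ^ 2 := by ring
    _ = (2 * n) * (2 * n) * ((1 + ε) * expct n r p (XH r k n) ^ 2) := by rw [← hfirst]; ring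

theorem stmt15 (r k : ℕ) (hr : 3 ≤ r) (hk : 1 ≤ k) :
    ∀ ε : ℝ, 0 < ε →
      ∃ C₀ : ℝ,
        4 * Real.exp 1 * (r : ℝ) ^ 2 * ((k + r - 2).choose (r - 1)) *
            ((2 * (k : ℝ) + 2 * r - 3) * Real.exp 1) ^
              ((1 : ℝ) / ((k + r - 2).choose (r - 1))) ≤ C₀ ∧
        ∀ C : ℝ, C₀ ≤ C →
          ∃ N : ℕ, ∀ n ≥ N,
            expct n r (C * (n : ℝ) ^ (-(1 : ℝ) / ((k + r - 2).choose (r - 1))))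
                (fun H => XH r k n H ^ 2)
              ≤ (1 + ε) *
                  (expct n r (C * (n : ℝ) ^ (-(1 : ℝ) / ((k + r - 2).choose (r - 1))))
                    (XH r k n)) ^ 2 := by
  intro ε hε
  set M := (k + r - 2).choose (r - 1)
  have hM : 0 < M := Nat.choose_pos (by omega)
  obtain ⟨x, hx, hev⟩ := sum_pow_card_followers_nearSet_le (k + r - 2) ε hε
  set c₀ : ℝ := 4 * Real.exp 1 * (r : ℝ) ^ 2 * M *
    ((2 * (k : ℝ) + 2 * r - 3) * Real.exp 1) ^ ((1 : ℝ) / M)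
  refine ⟨max c₀ (max 1 x⁻¹), le_max_left _ _, fun C hC => ?_⟩
  have hC1 : 1 ≤ C := ((le_max_left _ _).trans (le_max_right _ _)).trans hC
  have hCx : x⁻¹ ≤ C := ((le_max_right _ _).trans (le_max_right _ _)).trans hC
  have hC0 : 0 < C := by linarith
  refine Filter.eventually_atTop.1 ?_
  filter_upwards [hev, Filter.eventually_ge_atTop 3,
    Filter.eventually_ge_atTop ⌈C ^ M⌉₊] with n hn hn3 hnC
  have : NeZero n := ⟨by omega⟩
  have hnR : (0 : ℝ) < n := by exact_mod_cast NeZero.pos n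
  have hnC : C ^ M ≤ n := Nat.ceil_le.1 hnC
  set p : ℝ := C * (n : ℝ) ^ (-(1 : ℝ) / M)
  have hp : 0 < p := by positivity
  have hpM : p ^ M = C ^ M / n := by
    have hMR : (M : ℝ) ≠ 0 := by exact_mod_cast hM.ne'
    rw [mul_pow, ← Real.rpow_mul_natCast hnR.le, div_mul_cancel₀ _ hMR, Real.rpow_neg_one,
      div_eq_mul_inv]
  have hpM1 : p ^ M ≤ 1 := by
    rw [hpM]
    exact div_le_one_of_le₀ hnC hnR.le
  have hp1 : p ≤ 1 := (pow_le_one_iff_of_nonneg hp.le hM.ne').1 hpM1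
  refine expct_XH_sq_le hn3 r k hr p ε hp hp1 (hn _ ?_ ?_)
  · rw [inv_pow]
    exact (one_le_inv₀ (by positivity)).2 hpM1
  · rw [inv_pow, hpM, inv_div, div_le_iff₀ (by positivity)]
    have h1 : C ≤ C ^ M := le_self_pow₀ hC1 hM.ne'
    have h2 : 1 ≤ x * C ^ M := by
      rw [← mul_inv_cancel₀ hx.ne']
      gcongr
      exact hCx.trans h1
    nlinarith

end
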